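/- Fix integers n ≥ 2, ℓ ≥ 0, k ≥ 0 and a real b > 0. Let α = (1/2)·√((n−2)² + 4bℓ(n−2+ℓ)) and γ = −n/2 + 1 − ℓ + α, and let λ = −(γ + ℓ)/2 − k. Let p : ℝⁿ → ℝ be a harmonic polynomial that is homogeneous of degree ℓ (i.e. Δp = 0 and p(tx) = t^ℓ p(x) for t > 0), and define u(x) = p(x) |x|^γ e^(−|x|²/4) L_k^(α)(|x|²/4), where L_k^(α) is the generalized Laguerre polynomial of degree k with parameter α. Then for every x ∈ ℝⁿ with x ≠ 0, u satisfies the eigenvalue equation div(A_b(x) ∇u(x)) + (1/2) x · ∇u(x) + (n/2) u(x) = λ u(x), where A_b(x) = b·𝟙 + (1−b) (x ⊗ x)/|x|². -/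

import Mathlib

open scoped RealInnerProductSpace

noncomputable section

/-- The divergence `div F(x) = ∑ᵢ ∂ᵢ Fᵢ(x)` of a vector field on `ℝⁿ`. -/
def diverg {n : ℕ} (F : EuclideanSpace ℝ (Fin n) → EuclideanSpace ℝ (Fin n))
    (x : EuclideanSpace ℝ (Fin n)) : ℝ :=
  ∑ i, fderiv ℝ F x (EuclideanSpace.single i 1) i

/-- The Meyers–Serrin matrix `A_b(x) = b·𝟙 + (1-b) (x⊗x)/|x|²`, acting on a vector `v`. -/
def meyersSerrin {n : ℕ} (b : ℝ) (x v : EuclideanSpace ℝ (Fin n)) :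
    EuclideanSpace ℝ (Fin n) :=
  b • v + (((1 - b) * ⟪x, v⟫) / ‖x‖ ^ 2) • x

/-- The generalized Laguerre polynomial
`L_k^(α)(y) = ∑_{i=0}^{k} ((-1)^i / i!) (∏_{j=i+1}^{k} (α+j) / (k-i)!) yⁱ`. -/
def laguerre (k : ℕ) (α : ℝ) (y : ℝ) : ℝ :=
  ∑ i ∈ Finset.range (k + 1),
    ((-1 : ℝ) ^ i / (Nat.factorial i)) *
      ((∏ j ∈ Finset.Ioc i k, (α + (j : ℝ))) / (Nat.factorial (k - i))) * y ^ i

theorem aux_lag (k : ℕ) (c : ℕ → ℝ) (α y : ℝ)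
    (hc : ∀ i, i < k → ((i:ℝ)+1)*((i:ℝ)+1+α)*c (i+1) + ((k:ℝ)-i) * c i = 0) :
    y * (∑ i ∈ Finset.range (k+1), c i * ((i:ℝ) * (((i-1:ℕ):ℝ) * y^(i-1-1))))
     + (α+1-y) * (∑ i ∈ Finset.range (k+1), c i * ((i:ℝ) * y^(i-1)))
     + k * (∑ i ∈ Finset.range (k+1), c i * y^i) = 0 := by
  have e : ∀ i : ℕ, y * (c i * ((i:ℝ) * (((i-1:ℕ):ℝ) * y^(i-1-1))))
     + (α+1-y) * (c i * ((i:ℝ) * y^(i-1))) + k * (c i * y^i)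
     = (i:ℝ)*((i:ℝ)+α) * c i * y^(i-1) + ((k:ℝ)-i) * c i * y^i := by
    intro i
    rcases i with _ | _ | i
    · simp
    · simp; ring
    · simp [pow_succ]; ring
  rw [Finset.mul_sum, Finset.mul_sum, Finset.mul_sum, ← Finset.sum_add_distrib,
    ← Finset.sum_add_distrib, Finset.sum_congr rfl (fun i _ => e i), Finset.sum_add_distrib,
    Finset.sum_range_succ', Finset.sum_range_succ (fun i : ℕ => ((k:ℝ)-i) * c i * y^i)]
  simp only [Nat.cast_zero, zero_mul, sub_self, add_zero]
  rw [← Finset.sum_add_distrib]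
  refine Finset.sum_eq_zero fun i hi => ?_
  have := hc i (Finset.mem_range.1 hi)
  push_cast
  try simp only [Nat.add_sub_cancel]
  linear_combination y^i * this

theorem lag_ode (k : ℕ) (α : ℝ) : ∃ L1 L2 : ℝ → ℝ,
    (∀ y, HasDerivAt (laguerre k α) (L1 y) y) ∧ (∀ y, HasDerivAt L1 (L2 y) y) ∧
    ∀ y, y * L2 y + (α + 1 - y) * L1 y + k * laguerre k α y = 0 := by
  set c : ℕ → ℝ := fun i => ((-1 : ℝ) ^ i / (Nat.factorial i)) *
      ((∏ j ∈ Finset.Ioc i k, (α + (j : ℝ))) / (Nat.factorial (k - i))) with hcdef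
  have hL : laguerre k α = fun y => ∑ i ∈ Finset.range (k+1), c i * y^i := by
    funext y; rfl
  refine ⟨fun y => ∑ i ∈ Finset.range (k+1), c i * ((i:ℝ) * y^(i-1)),
    fun y => ∑ i ∈ Finset.range (k+1), c i * ((i:ℝ) * (((i-1:ℕ):ℝ) * y^(i-1-1))), ?_, ?_, ?_⟩
  · intro y
    rw [hL]
    exact HasDerivAt.fun_sum fun i _ => (hasDerivAt_pow i y).const_mul (c i)
  · intro y
    exact HasDerivAt.fun_sum fun i _ => ((hasDerivAt_pow (i-1) y).const_mul (i:ℝ)).const_mul (c i)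
  · intro y
    rw [hL]
    refine aux_lag k c α y ?_
    intro i hi
    have h1 : ∏ j ∈ Finset.Ioc i k, (α + (j : ℝ))
        = (α + i + 1) * ∏ j ∈ Finset.Ioc (i+1) k, (α + (j : ℝ)) := by
      have : Finset.Ioc i k = insert (i+1) (Finset.Ioc (i+1) k) := by
        ext j; simp; omega
      rw [this, Finset.prod_insert (by simp)]
      push_cast; ring
    obtain ⟨m, rfl⟩ : ∃ m, k = i + 1 + m := ⟨k - (i+1), by omega⟩
    simp only [hcdef]
    rw [h1]
    have h2 : i + 1 + m - i = m + 1 := by omega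
    have h3 : i + 1 + m - (i + 1) = m := by omega
    rw [h2, h3, Nat.factorial_succ, Nat.factorial_succ]
    have := Nat.factorial_ne_zero i
    have := Nat.factorial_ne_zero m
    push_cast
    have : (i:ℝ) + 1 ≠ 0 := by positivity
    have : (m:ℝ) + 1 ≠ 0 := by positivity
    field_simp
    ring

/-- Radial ODE. -/
theorem radial_ode (n ℓ k : ℕ) (b α γ lam : ℝ)
    (hα : α ^ 2 = (((n : ℝ) - 2) ^ 2 + 4 * b * ℓ * ((n : ℝ) - 2 + ℓ)) / 4)
    (hγ : γ = -(n : ℝ) / 2 + 1 - ℓ + α)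
    (hlam : lam = -(γ + ℓ) / 2 - k) : ∃ G1 G2 : ℝ → ℝ,
    (∀ s, 0 < s → HasDerivAt (fun s => s ^ (γ/2) * Real.exp (-s/4) * laguerre k α (s/4)) (G1 s) s) ∧
    (∀ s, 0 < s → HasDerivAt G1 (G2 s) s) ∧
    ∀ s, 0 < s → ∀ g, g = s ^ (γ/2) * Real.exp (-s/4) * laguerre k α (s/4) →
      2 * b * ℓ * G1 s + (ℓ + n) * (2 * G1 s + (1-b) * ℓ * g / s)
      + 2 * s * (2 * G2 s + (1-b) * ℓ * (G1 s * s - g) / s^2)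
      + 1/2 * (ℓ * g + 2 * s * G1 s) + n / 2 * g = lam * g := by
  obtain ⟨L1, L2, h1, h2, h3⟩ := lag_ode k α
  set w : ℝ → ℝ := fun s => s ^ (γ/2) * Real.exp (-s/4) with hw
  have hwd : ∀ s, 0 < s → HasDerivAt w ((γ/(2*s) - 1/4) * w s) s := by
    intro s hs
    have ha := (Real.hasDerivAt_rpow_const (p := γ/2) (Or.inl hs.ne'))
    have hb := (((hasDerivAt_id s).neg.div_const 4).exp)
    refine (ha.mul hb).congr_deriv ?_
    simp only [hw, Real.rpow_sub_one hs.ne']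
    simp
    field_simp
    ring
  have hLd : ∀ s, HasDerivAt (fun s => laguerre k α (s/4)) (L1 (s/4) / 4) s := by
    intro s
    have := (h1 (s/4)).comp s ((hasDerivAt_id s).div_const 4)
    exact this.congr_deriv (by ring)
  have hL1d : ∀ s, HasDerivAt (fun s => L1 (s/4)) (L2 (s/4) / 4) s := by
    intro s
    have := (h2 (s/4)).comp s ((hasDerivAt_id s).div_const 4)
    exact this.congr_deriv (by ring)
  refine ⟨fun s => w s * ((γ/2 * s⁻¹ - 1/4) * laguerre k α (s/4) + L1 (s/4) / 4),
    fun s => w s * ((γ/2 * s⁻¹ - 1/4)^2 * laguerre k α (s/4) - γ/2 * (s^2)⁻¹ * laguerre k α (s/4)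
      + (γ/2 * s⁻¹ - 1/4) * L1 (s/4) / 2 + L2 (s/4) / 16), ?_, ?_, ?_⟩
  · intro s hs
    refine ((hwd s hs).mul (hLd s)).congr_deriv ?_
    field_simp
    try ring
  · intro s hs
    have hc : HasDerivAt (fun s : ℝ => γ/2 * s⁻¹ - 1/4) (γ/2 * (-(s^2)⁻¹)) s :=
      ((hasDerivAt_inv hs.ne').const_mul (γ/2)).sub_const (1/4)
    refine ((hwd s hs).mul ((hc.mul (hLd s)).add ((hL1d s).div_const 4))).congr_deriv ?_
    simp only [Pi.mul_apply, Pi.add_apply]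
    field_simp
    ring
  · intro s hs g hg
    have hg' : g = w s * laguerre k α (s/4) := hg
    have hode := h3 (s/4)
    beta_reduce
    rw [hg']
    generalize w s = W at *
    generalize laguerre k α (s/4) = L at *
    generalize L1 (s/4) = M at *
    have hN : L2 (s/4) = -((α + 1 - s/4) * M + k * L) * 4 / s := by
      field_simp
      linear_combination 4 * hode
    rw [hN]
    have hn : (n:ℝ) = 2 * (1 - ℓ + α - γ) := by linear_combination 2 * hγ
    rw [hlam]
    rw [hn] at hα ⊢
    have key : ∀ A B : ℝ, A - B = W * L / s * (α ^ 2 - ((2 * (1 - ℓ + α - γ) - 2) ^ 2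
        + 4 * b * ℓ * (2 * (1 - ℓ + α - γ) - 2 + ℓ)) / 4) → A = B := by
      intro A B h
      rw [hα, sub_self, mul_zero] at h
      linarith
    apply key
    field_simp
    ring


theorem diverg_smul {n : ℕ} (g : EuclideanSpace ℝ (Fin n) → ℝ) (V : EuclideanSpace ℝ (Fin n) → EuclideanSpace ℝ (Fin n)) (x v : EuclideanSpace ℝ (Fin n))
    (hg : HasGradientAt g v x) (hV : DifferentiableAt ℝ V x) :
    diverg (fun z => g z • V z) x = g x * diverg V x + ⟪v, V x⟫ := by
  unfold diverg
  have h := (hg.hasFDerivAt.smul hV.hasFDerivAt).fderiv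
  have h' : fderiv ℝ (fun z => g z • V z) x = _ := h
  rw [h']
  simp [Finset.sum_add_distrib, Finset.mul_sum, PiLp.inner_apply, EuclideanSpace.inner_single_right]
  exact Finset.sum_congr rfl fun i _ => by ring

theorem diverg_add {n : ℕ} (U V : EuclideanSpace ℝ (Fin n) → EuclideanSpace ℝ (Fin n)) (x : EuclideanSpace ℝ (Fin n))
    (hU : DifferentiableAt ℝ U x) (hV : DifferentiableAt ℝ V x) :
    diverg (fun z => U z + V z) x = diverg U x + diverg V x := by
  unfold diverg
  rw [fderiv_fun_add hU hV]
  simp [Finset.sum_add_distrib]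

theorem diverg_id {n : ℕ} (x : EuclideanSpace ℝ (Fin n)) : diverg (fun z : EuclideanSpace ℝ (Fin n) => z) x = n := by
  unfold diverg
  simp

theorem hasGrad_radial {n : ℕ} (G : ℝ → ℝ) (g' : ℝ) (x : EuclideanSpace ℝ (Fin n)) (h : HasDerivAt G g' (‖x‖^2)) :
    HasGradientAt (fun z : EuclideanSpace ℝ (Fin n) => G (‖z‖^2)) ((2 * g') • x) x := by
  rw [hasGradientAt_iff_hasFDerivAt]
  have := h.comp_hasFDerivAt x (hasStrictFDerivAt_norm_sq x).hasFDerivAt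
  refine this.congr_fderiv ?_
  ext v
  simp [inner_smul_left]
  ring

theorem hasGrad_mul {n : ℕ} (f g : EuclideanSpace ℝ (Fin n) → ℝ) (v w x : EuclideanSpace ℝ (Fin n)) (hf : HasGradientAt f v x)
    (hg : HasGradientAt g w x) :
    HasGradientAt (fun z => f z * g z) (f x • w + g x • v) x := by
  rw [hasGradientAt_iff_hasFDerivAt] at *
  refine (hf.mul hg).congr_fderiv ?_
  simp

theorem main_aux {n : ℕ}
    (ℓ : ℕ) (b lam : ℝ) (G G1 G2 : ℝ → ℝ)
    (hG : ∀ s, 0 < s → HasDerivAt G (G1 s) s)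
    (hG1 : ∀ s, 0 < s → HasDerivAt G1 (G2 s) s)
    (hode : ∀ s, 0 < s → 
      2 * b * ℓ * G1 s + (ℓ + n) * (2 * G1 s + (1-b) * ℓ * G s / s)
      + 2 * s * (2 * G2 s + (1-b) * ℓ * (G1 s * s - G s) / s^2)
      + 1/2 * (ℓ * G s + 2 * s * G1 s) + n / 2 * G s = lam * G s)
    (p : EuclideanSpace ℝ (Fin n) → ℝ) (hp : ContDiff ℝ 2 p)
    (hp_harm : ∀ x, diverg (gradient p) x = 0)
    (hp_hom : ∀ t : ℝ, 0 < t → ∀ x, p (t • x) = t ^ ℓ * p x)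
    (u : EuclideanSpace ℝ (Fin n) → ℝ)
    (hu : ∀ x, x ≠ 0 → u x = p x * G (‖x‖^2)) (x : EuclideanSpace ℝ (Fin n)) (hx : x ≠ 0) :
      diverg (fun z => meyersSerrin b z (gradient u z)) x
          + (1 / 2) * ⟪x, gradient u x⟫ + ((n : ℝ) / 2) * u x = lam * u x := by
  have hpd : ∀ z, HasGradientAt p (gradient p z) z := fun z =>
    (hp.differentiable (by norm_num) z).hasGradientAt
  have hpos : ∀ z : EuclideanSpace ℝ (Fin n), z ≠ 0 → 0 < ‖z‖^2 := fun z hz => by positivity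
  have heul : ∀ z, ⟪z, gradient p z⟫ = ℓ * p z := by
    intro z
    have h1 : HasDerivAt (fun t : ℝ => t • z) z 1 := by
      simpa using (hasDerivAt_id (1:ℝ)).smul_const z
    have h2 := hpd ((1:ℝ) • z)
    rw [hasGradientAt_iff_hasFDerivAt] at h2
    have h3 := h2.comp_hasDerivAt (1:ℝ) h1
    have h4 : HasDerivAt (fun t : ℝ => t ^ ℓ * p z) (ℓ * p z) 1 := by
      simpa using (hasDerivAt_pow ℓ (1:ℝ)).mul_const (p z)
    have h5 : (p ∘ fun t : ℝ => t • z) =ᶠ[nhds 1] fun t : ℝ => t ^ ℓ * p z := by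
      filter_upwards [lt_mem_nhds (zero_lt_one' ℝ)] with t ht using hp_hom t ht z
    have h6 := (h4.congr_of_eventuallyEq h5).unique h3
    rw [h6]
    simp [real_inner_comm]
  have hne : ∀ z : EuclideanSpace ℝ (Fin n), z ≠ 0 → ∀ᶠ y in nhds z, y ≠ 0 := fun z hz => isOpen_ne.mem_nhds hz
  have hgu : ∀ z, z ≠ 0 → gradient u z
      = p z • ((2 * G1 (‖z‖^2)) • z) + G (‖z‖^2) • gradient p z := by
    intro z hz
    have h := hasGrad_mul p (fun z => G (‖z‖^2)) _ _ z (hpd z)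
      (hasGrad_radial G _ z (hG _ (hpos z hz)))
    refine (h.congr_of_eventuallyEq ?_).gradient
    filter_upwards [hne z hz] with y hy using hu y hy
  have hin : ∀ z, z ≠ 0 → ⟪z, gradient u z⟫ =
      p z * (ℓ * G (‖z‖^2) + 2 * ‖z‖^2 * G1 (‖z‖^2)) := by
    intro z hz
    rw [hgu z hz, inner_add_right, inner_smul_right, inner_smul_right, inner_smul_right, heul,
      real_inner_self_eq_norm_sq]
    ring
  set H : ℝ → ℝ := fun s => 2 * G1 s + (1-b) * ℓ * (G s / s) with hH
  have hHd : ∀ s, 0 < s → HasDerivAt H (2 * G2 s + (1-b) * ℓ * ((G1 s * s - G s) / s^2)) s := by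
    intro s hs
    have h1 := ((hG s hs).div (hasDerivAt_id s) hs.ne').const_mul ((1-b) * ℓ)
    refine (((hG1 s hs).const_mul 2).add h1).congr_deriv ?_
    simp
  have hF : (fun z => meyersSerrin b z (gradient u z)) =ᶠ[nhds x]
      fun z => (b * G (‖z‖^2)) • gradient p z + (p z * H (‖z‖^2)) • z := by
    filter_upwards [hne x hx] with z hz
    have hz2 := (hpos z hz).ne'
    unfold meyersSerrin
    rw [hin z hz, hgu z hz, smul_add, smul_smul, smul_smul, smul_smul, add_comm (_ • z) _, add_assoc,
      ← add_smul]
    congr 2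
    simp only [hH]
    field_simp
    ring
  have hdiv : diverg (fun z => meyersSerrin b z (gradient u z)) x = 
      diverg (fun z => (b * G (‖z‖^2)) • gradient p z + (p z * H (‖z‖^2)) • z) x := by
    unfold diverg
    rw [hF.fderiv_eq]
  have hs := hpos x hx
  have hgp : DifferentiableAt ℝ (gradient p) x := by
    have h1 : DifferentiableAt ℝ (fderiv ℝ p) x :=
      (hp.fderiv_right (m := 1) (by norm_num)).differentiable (by norm_num) x
    exact ((InnerProductSpace.toDual ℝ (EuclideanSpace ℝ (Fin n))).symm.toContinuousLinearEquiv.differentiableAt).comp x h1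
  have hA := hasGrad_radial (fun s => b * G s) _ x ((hG _ hs).const_mul b)
  have hB := hasGrad_mul p (fun z => H (‖z‖^2)) _ _ x (hpd x) (hasGrad_radial H _ x (hHd _ hs))
  have e1 := diverg_add (fun z => (b * G (‖z‖^2)) • gradient p z) (fun z => (p z * H (‖z‖^2)) • z) x
    (hA.hasFDerivAt.differentiableAt.smul hgp)
    (hB.hasFDerivAt.differentiableAt.smul differentiableAt_id)
  have e2 := diverg_smul _ _ _ _ hA hgp
  have e3 := diverg_smul _ (fun z => z) _ _ hB differentiableAt_id
  rw [hdiv, e1, e2, e3, hp_harm, diverg_id, hin x hx, hu x hx]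
  have heul' : ⟪gradient p x, x⟫ = ℓ * p x := by rw [real_inner_comm, heul]
  simp only [inner_add_left, real_inner_smul_left, heul, heul', real_inner_self_eq_norm_sq]
  have := hode _ hs
  simp only [hH]
  linear_combination p x * this

/-- **Eigenfunctions of the Meyers–Serrin operator** (Proposition `Lbspec` of the paper).
With `α = ½√((n-2)² + 4bℓ(n-2+ℓ))`, `γ = -n/2 + 1 - ℓ + α` and `λ = -(γ+ℓ)/2 - k`,
if `p` is a harmonic polynomial homogeneous of degree `ℓ`, then
`u(x) = p(x) |x|^γ e^(-|x|²/4) L_k^(α)(|x|²/4)` satisfies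
`div(A_b ∇u) + ½ x·∇u + (n/2) u = λ u` on `ℝⁿ ∖ {0}`. -/
theorem meyersSerrin_eigenfunction
    {n : ℕ} (hn : 2 ≤ n) (ℓ k : ℕ) (b : ℝ) (hb : 0 < b)
    (α γ lam : ℝ)
    (hα : α = (1 / 2) * Real.sqrt (((n : ℝ) - 2) ^ 2 + 4 * b * ℓ * ((n : ℝ) - 2 + ℓ)))
    (hγ : γ = -(n : ℝ) / 2 + 1 - ℓ + α)
    (hlam : lam = -(γ + ℓ) / 2 - k)
    (p : EuclideanSpace ℝ (Fin n) → ℝ)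
    (hp_poly : ∃ P : MvPolynomial (Fin n) ℝ,
      ∀ x : EuclideanSpace ℝ (Fin n), p x = MvPolynomial.eval (fun i => x i) P)
    (hp_harm : ∀ x, diverg (gradient p) x = 0)
    (hp_hom : ∀ t : ℝ, 0 < t → ∀ x, p (t • x) = t ^ ℓ * p x)
    (u : EuclideanSpace ℝ (Fin n) → ℝ)
    (hu : ∀ x, u x = p x * ‖x‖ ^ γ * Real.exp (-‖x‖ ^ 2 / 4) * laguerre k α (‖x‖ ^ 2 / 4)) :
    ∀ x : EuclideanSpace ℝ (Fin n), x ≠ 0 →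
      diverg (fun z => meyersSerrin b z (gradient u z)) x
          + (1 / 2) * ⟪x, gradient u x⟫ + ((n : ℝ) / 2) * u x = lam * u x := by
  have hα2 : α ^ 2 = (((n : ℝ) - 2) ^ 2 + 4 * b * ℓ * ((n : ℝ) - 2 + ℓ)) / 4 := by
    have hn' : (0:ℝ) ≤ (n:ℝ) - 2 := by
      have : (2:ℝ) ≤ n := by exact_mod_cast hn
      linarith
    rw [hα, mul_pow, Real.sq_sqrt (by positivity)]
    ring
  obtain ⟨G1, G2, h1, h2, h3⟩ := radial_ode n ℓ k b α γ lam hα2 hγ hlam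
  obtain ⟨P, hP⟩ := hp_poly
  have hpc : ContDiff ℝ 2 p := by
    have : p = fun x : EuclideanSpace ℝ (Fin n) => MvPolynomial.eval (fun i => x i) P := funext hP
    rw [this]
    simp only [MvPolynomial.eval_eq]
    fun_prop
  refine fun x hx => main_aux ℓ b lam _ G1 G2 h1 h2 (fun s hs => h3 s hs _ rfl) p hpc hp_harm
    hp_hom u ?_ x hx
  intro z hz
  rw [hu z]
  have : (‖z‖ ^ 2) ^ (γ / 2) = ‖z‖ ^ γ := by
    rw [← Real.rpow_natCast, ← Real.rpow_mul (norm_nonneg z)]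
    congr 1
    push_cast
    ring
  rw [this]
  ring


end
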